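/- arXiv:2312.05620 — 3 statements merged into one kernel-verified Lean document; each statement's English description precedes it below -/
import Mathlib

section
/- For every prime power q ≥ 7, there exists a (q+1)-regular graph of girth exactly 7 on 2q³ + 2q² vertices; consequently n(q+1,7) ≤ 2(q+1)³ − 4(q+1)² + 2(q+1). -/
variable {P L X : Type*} {n : ℕ}

/-- Adjacency of the graph on points `P`, lines `L` and grid points `X × ZMod n`: points meet
their lines, each line meets its base grid point, and each row `{x} × ZMod n` carries a cycle. -/
def GridAdj (inc : P → L → Prop) (base : L → X × ZMod n) :
    P ⊕ L ⊕ (X × ZMod n) → P ⊕ L ⊕ (X × ZMod n) → Prop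
  | .inl p, .inr (.inl l) => inc p l
  | .inr (.inl l), .inl p => inc p l
  | .inr (.inl l), .inr (.inr g) => base l = g
  | .inr (.inr g), .inr (.inl l) => base l = g
  | .inr (.inr g), .inr (.inr h) => g ≠ h ∧ g.1 = h.1 ∧ (h.2 = g.2 + 1 ∨ g.2 = h.2 + 1)
  | _, _ => False

/-- The graph with adjacency `GridAdj`. -/
def gridGraph (inc : P → L → Prop) (base : L → X × ZMod n) :
    SimpleGraph (P ⊕ L ⊕ (X × ZMod n)) where
  Adj := GridAdj inc base
  symm := ⟨by
    rintro (p | l | g) (p' | l' | g') h <;> simp_all only [GridAdj]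
    exact ⟨h.1.symm, trivial, h.2.2.symm⟩⟩
  loopless := ⟨by rintro (p | l | g) h <;> simp_all [GridAdj]⟩

theorem ZMod.natCast_ne_zero_of_lt {k : ℕ} (h0 : 0 < k) (hk : k < n) : (k : ZMod n) ≠ 0 := by
  rw [Ne, ZMod.natCast_eq_zero_iff]
  exact fun h => absurd (Nat.le_of_dvd h0 h) (by omega)

/-- The incidence conditions that exclude cycles of length at most six. -/
structure IsGridSystem (inc : P → L → Prop) (base : L → X × ZMod n) : Prop where
  linear : ∀ {p p' l l'}, inc p l → inc p l' → inc p' l → inc p' l' → l ≠ l' → p = p'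
  triangle : ∀ {p p' p'' l l' l''}, inc p l → inc p' l → inc p' l' → inc p'' l' → inc p'' l'' →
    inc p l'' → p ≠ p' → p' ≠ p'' → p'' ≠ p → l ≠ l' → l' ≠ l'' → l'' ≠ l → False
  row : ∀ {p l l'}, inc p l → inc p l' → (base l).1 = (base l').1 → l = l'
  base : ∀ {p p' l l' m}, inc p l → inc p m → inc p' m → inc p' l' → base l = base l' → l ≠ m →
    l = l'

section Girth
variable {inc : P → L → Prop} {base : L → X × ZMod n}

theorem GridAdj.no_triangle (hn : 7 ≤ n) {a b c}
    (hab : GridAdj inc base a b) (hbc : GridAdj inc base b c) (hca : GridAdj inc base c a) :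
    False := by
  have h3 : ((3 : ℕ) : ZMod n) ≠ 0 := ZMod.natCast_ne_zero_of_lt (by omega) (by omega)
  push_cast at h3
  rcases a with a | a | a <;> rcases b with b | b | b <;> (try exact hab) <;>
  rcases c with c | c | c <;> (try exact hbc) <;> (try exact hca) <;>
  simp only [GridAdj] at * <;> grind

theorem IsGridSystem.no_square (h : IsGridSystem inc base) (hn : 7 ≤ n) {a b c d}
    (hab : GridAdj inc base a b) (hbc : GridAdj inc base b c) (hcd : GridAdj inc base c d)
    (hda : GridAdj inc base d a) (hac : a ≠ c) (hbd : b ≠ d) : False := by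
  have h4 : ((4 : ℕ) : ZMod n) ≠ 0 := ZMod.natCast_ne_zero_of_lt (by omega) (by omega)
  push_cast at h4
  rcases a with a | a | a <;> rcases b with b | b | b <;> (try exact hab) <;>
  rcases c with c | c | c <;> (try exact hbc) <;>
  rcases d with d | d | d <;> (try exact hcd) <;> (try exact hda) <;>
  simp only [GridAdj, ne_eq, Sum.inl.injEq, Sum.inr.injEq] at * <;> grind [h.linear, h.row]

theorem IsGridSystem.no_pentagon (h : IsGridSystem inc base) (hn : 7 ≤ n) {a b c d e}
    (hab : GridAdj inc base a b) (hbc : GridAdj inc base b c) (hcd : GridAdj inc base c d)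
    (hde : GridAdj inc base d e) (hea : GridAdj inc base e a)
    (hac : a ≠ c) (hbd : b ≠ d) (hce : c ≠ e) (hda : d ≠ a) (heb : e ≠ b) : False := by
  have h5 : ((5 : ℕ) : ZMod n) ≠ 0 := ZMod.natCast_ne_zero_of_lt (by omega) (by omega)
  push_cast at h5
  rcases a with a | a | a <;> rcases b with b | b | b <;> (try exact hab) <;>
  rcases c with c | c | c <;> (try exact hbc) <;>
  rcases d with d | d | d <;> (try exact hcd) <;>
  rcases e with e | e | e <;> (try exact hde) <;> (try exact hea) <;>
  simp only [GridAdj, ne_eq, Sum.inl.injEq, Sum.inr.injEq] at * <;> grind [h.row]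

theorem IsGridSystem.no_hexagon (h : IsGridSystem inc base) (hn : 7 ≤ n) {a b c d e f}
    (hab : GridAdj inc base a b) (hbc : GridAdj inc base b c) (hcd : GridAdj inc base c d)
    (hde : GridAdj inc base d e) (hef : GridAdj inc base e f) (hfa : GridAdj inc base f a)
    (hac : a ≠ c) (hbd : b ≠ d) (hce : c ≠ e) (hdf : d ≠ f) (hea : e ≠ a) (hfb : f ≠ b) :
    False := by
  have h6 : ((6 : ℕ) : ZMod n) ≠ 0 := ZMod.natCast_ne_zero_of_lt (by omega) (by omega)
  push_cast at h6
  rcases a with a | a | a <;> rcases b with b | b | b <;> (try exact hab) <;>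
  rcases c with c | c | c <;> (try exact hbc) <;>
  rcases d with d | d | d <;> (try exact hcd) <;>
  rcases e with e | e | e <;> (try exact hde) <;>
  rcases f with f | f | f <;> (try exact hef) <;> (try exact hfa) <;>
  simp only [GridAdj, ne_eq, Sum.inl.injEq, Sum.inr.injEq] at * <;>
  grind [h.row, h.base, h.triangle]

theorem IsGridSystem.seven_le_egirth (h : IsGridSystem inc base) (hn : 7 ≤ n) :
    7 ≤ (gridGraph inc base).egirth := by
  rw [SimpleGraph.le_egirth]
  intro a w hw
  by_contra! hlt
  have hlt' : w.length < 7 := by exact_mod_cast hlt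
  have h3 := hw.three_le_length
  have hadj : ∀ i < w.length, GridAdj inc base (w.getVert i) (w.getVert (i + 1)) :=
    fun i hi => w.adj_getVert_succ hi
  have hlast : w.getVert w.length = w.getVert 0 := by simp
  have hne : ∀ i < w.length, ∀ j < w.length, i ≠ j → w.getVert i ≠ w.getVert j :=
    fun i hi j hj hij he => hij (hw.getVert_injOn' (by simp; omega) (by simp; omega) he)
  generalize w.length = k at *
  interval_cases k
  · exact GridAdj.no_triangle hn (hadj 0 (by simp)) (hadj 1 (by simp))
      (hlast ▸ hadj 2 (by simp))
  · exact h.no_square hn (hadj 0 (by simp)) (hadj 1 (by simp)) (hadj 2 (by simp))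
      (hlast ▸ hadj 3 (by simp)) (by apply hne <;> simp) (by apply hne <;> simp)
  · apply h.no_pentagon hn (hadj 0 (by simp)) (hadj 1 (by simp)) (hadj 2 (by simp))
      (hadj 3 (by simp)) (hlast ▸ hadj 4 (by simp)) <;> apply hne <;> simp
  · apply h.no_hexagon hn (hadj 0 (by simp)) (hadj 1 (by simp)) (hadj 2 (by simp))
      (hadj 3 (by simp)) (hadj 4 (by simp)) (hlast ▸ hadj 5 (by simp)) <;> apply hne <;> simp

end Girth

section Symplectic
variable {F : Type*} [Field F]

/-- The determinant of two vectors of the plane. -/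
def planeDet (u v : F × F) : F := u.1 * v.2 - u.2 * v.1

theorem eq_of_planeDet_eq {u v w w' : F × F} (h : planeDet u v ≠ 0)
    (hu : planeDet u w = planeDet u w') (hv : planeDet v w = planeDet v w') : w = w' := by
  simp only [planeDet] at *
  ext <;> apply mul_left_cancel₀ h <;> grind

theorem exists_planeDet_eq_iff {v : F × F} (hv : v ≠ 0) (d : F) :
    ∃ w₀ : F × F, ∀ w, planeDet v w = d ↔ ∃ t : F, w₀ + t • v = w := by
  obtain ⟨a, b⟩ := v
  by_cases ha : a = 0
  · have hb : b ≠ 0 := by rintro rfl; simp [ha] at hv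
    refine ⟨(-d / b, 0), fun w => ⟨fun h => ⟨w.2 / b, ?_⟩, ?_⟩⟩
    · simp only [planeDet] at h
      ext <;> simp <;> grind
    · rintro ⟨t, rfl⟩
      simp [planeDet]
      grind
  · refine ⟨(0, d / a), fun w => ⟨fun h => ⟨w.1 / a, ?_⟩, ?_⟩⟩
    · simp only [planeDet] at h
      ext <;> simp <;> grind
    · rintro ⟨t, rfl⟩
      simp [planeDet]
      grind

/-- Standard representatives of the points of the projective line `Option F`. -/
def projRep : Option F → F × F
  | none => (0, 1)
  | some t => (1, t)

theorem planeDet_projRep {x z : Option F} (h : x ≠ z) : planeDet (projRep x) (projRep z) ≠ 0 := by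
  rcases x with _ | x <;> rcases z with _ | z <;> simp_all [planeDet, projRep, sub_eq_zero, eq_comm]

theorem projRep_ne_zero (x : Option F) : projRep x ≠ 0 := by
  rcases x with _ | x <;> simp [projRep]

theorem exists_smul_projRep {v : F × F} (hv : v ≠ 0) :
    ∃ (y : Option F) (c : Fˣ), v = c • projRep y := by
  obtain ⟨a, b⟩ := v
  by_cases ha : a = 0
  · have hb : b ≠ 0 := by rintro rfl; simp [ha] at hv
    exact ⟨none, Units.mk0 b hb, by simp [projRep, ha, Units.smul_def]⟩
  · exact ⟨some (b / a), Units.mk0 a ha, by simp [projRep, Units.smul_def]; field_simp⟩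

theorem smul_projRep_inj {y y' : Option F} {c c' : Fˣ} (h : c • projRep y = c' • projRep y') :
    y = y' ∧ c = c' := by
  rcases y with _ | y <;> rcases y' with _ | y' <;>
    simp only [projRep, Units.smul_def, Prod.smul_mk, smul_eq_mul, Prod.mk.injEq,
      Units.ext_iff] at * <;>
    have := c.ne_zero <;> have := c'.ne_zero <;> grind

/-- Pairs of vectors of determinant one, that is, the elements of `SL₂(F)` given by columns. -/
abbrev UnimodularPair (F : Type*) [Field F] := {p : (F × F) × (F × F) // planeDet p.1 p.2 = 1}

/-- The action of a unimodular pair on the plane. -/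
def UnimodularPair.app (A : UnimodularPair F) (v : F × F) : F × F := v.1 • A.1.1 + v.2 • A.1.2

theorem planeDet_app (A : UnimodularPair F) (u v : F × F) :
    planeDet (A.app u) (A.app v) = planeDet u v := by
  have := A.2
  simp only [planeDet, UnimodularPair.app, Prod.fst_add, Prod.snd_add, Prod.smul_fst,
    Prod.smul_snd, smul_eq_mul] at *
  linear_combination (u.1 * v.2 - u.2 * v.1) * this

theorem UnimodularPair.ext_of_app {A B : UnimodularPair F} {u v : F × F} (h : planeDet u v ≠ 0)
    (hu : A.app u = B.app u) (hv : A.app v = B.app v) : A = B := by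
  obtain ⟨⟨⟨a, b⟩, ⟨c, d⟩⟩, hA⟩ := A
  obtain ⟨⟨⟨a', b'⟩, ⟨c', d'⟩⟩, hB⟩ := B
  simp only [planeDet, UnimodularPair.app, Prod.ext_iff, Prod.fst_add, Prod.snd_add, Prod.smul_fst,
    Prod.smul_snd, smul_eq_mul] at *
  congr <;> apply mul_left_cancel₀ h <;> grind

theorem UnimodularPair.exists_app {u v u' v' : F × F} (h : planeDet u v ≠ 0)
    (h' : planeDet u v = planeDet u' v') : ∃ A : UnimodularPair F, A.app u = u' ∧ A.app v = v' := by
  refine ⟨⟨((planeDet u v)⁻¹ • (v.2 • u' - u.2 • v'),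
    (planeDet u v)⁻¹ • (u.1 • v' - v.1 • u')), ?_⟩, ?_, ?_⟩
  · generalize hD : planeDet u v = D at *
    simp only [planeDet, Prod.fst_sub, Prod.snd_sub, Prod.smul_fst,
      Prod.smul_snd, smul_eq_mul] at *
    grind
  all_goals
    simp only [UnimodularPair.app]
    generalize hD : planeDet u v = D at *
    ext <;> simp only [planeDet, Prod.fst_add, Prod.snd_add, Prod.fst_sub,
      Prod.snd_sub, Prod.smul_fst, Prod.smul_snd, smul_eq_mul] at * <;> grind

theorem UnimodularPair.app_ne_zero (A : UnimodularPair F) (x : Option F) :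
    A.app (projRep x) ≠ 0 := by
  intro h
  rcases x with _ | x
  · exact planeDet_projRep (F := F) (x := none) (z := some 0) (by simp)
      (by rw [← planeDet_app A, h]; simp [planeDet])
  · exact planeDet_projRep (F := F) (x := some x) (z := none) (by simp)
      (by rw [← planeDet_app A, h]; simp [planeDet])

/-- The pair `A` lies on the line `(x, y, c)` when it maps the vector of `x` to `c` times the
vector of `y`. -/
def UnimodularPair.Inc (A : UnimodularPair F) (l : Option F × Option F × Fˣ) : Prop :=
  A.app (projRep l.1) = l.2.2 • projRep l.2.1

theorem UnimodularPair.Inc.eq_of_fst_eq {A : UnimodularPair F} {l l' : Option F × Option F × Fˣ}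
    (h : A.Inc l) (h' : A.Inc l') (hx : l.1 = l'.1) : l = l' := by
  obtain ⟨x, y, c⟩ := l
  obtain ⟨x', y', c'⟩ := l'
  obtain rfl : x = x' := hx
  obtain ⟨rfl, rfl⟩ := smul_projRep_inj (h.symm.trans h')
  rfl

theorem UnimodularPair.exists_inc (A : UnimodularPair F) (x : Option F) :
    ∃ yc : Option F × Fˣ, A.Inc (x, yc) := by
  obtain ⟨y, c, h⟩ := exists_smul_projRep (A.app_ne_zero x)
  exact ⟨(y, c), h⟩

theorem exists_parametrization (l : Option F × Option F × Fˣ) :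
    ∃ f : F → UnimodularPair F, f.Injective ∧ ∀ A, UnimodularPair.Inc A l ↔ ∃ t, f t = A := by
  obtain ⟨z, hz⟩ := exists_ne l.1
  have hd := planeDet_projRep hz.symm
  have hv : l.2.2 • projRep l.2.1 ≠ 0 := by
    rw [Ne, smul_eq_zero_iff_eq]; exact projRep_ne_zero _
  obtain ⟨w, hw⟩ := exists_planeDet_eq_iff hv (planeDet (projRep l.1) (projRep z))
  have key : ∀ t : F, ∃ A : UnimodularPair F, A.app (projRep l.1) = l.2.2 • projRep l.2.1 ∧
      A.app (projRep z) = w + t • (l.2.2 • projRep l.2.1) :=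
    fun t => UnimodularPair.exists_app hd ((hw _).2 ⟨t, rfl⟩).symm
  choose f hf hf' using key
  refine ⟨f, fun s t hst => ?_, fun A => ⟨fun hA => ?_, ?_⟩⟩
  · have := hf' s
    rw [hst, hf' t, add_right_inj] at this
    exact (smul_left_injective F hv this).symm
  · obtain ⟨t, ht⟩ := (hw (A.app (projRep z))).1 (by rw [← planeDet_app A (projRep l.1), hA])
    exact ⟨t, UnimodularPair.ext_of_app hd ((hf t).trans hA.symm) ((hf' t).trans ht)⟩
  · rintro ⟨t, rfl⟩
    exact hf t

theorem isGridSystem_unimodularPair {n : ℕ} (φ : Option F ≃ ZMod n) :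
    IsGridSystem UnimodularPair.Inc
      (fun l : Option F × Option F × Fˣ => (l.1, φ l.2.1)) where
  linear h₁ h₂ h₃ h₄ hne := by
    have hx := fun hx => hne (h₁.eq_of_fst_eq h₂ hx)
    exact UnimodularPair.ext_of_app (planeDet_projRep hx) (h₁.trans h₃.symm) (h₂.trans h₄.symm)
  row h h' hx := h.eq_of_fst_eq h' hx
  base {A B l l' m} h₁ h₂ h₃ h₄ hb hne := by
    have hx := planeDet_projRep fun hx => hne (h₁.eq_of_fst_eq h₂ hx)
    obtain ⟨x, y, c⟩ := l
    obtain ⟨x', y', c'⟩ := l'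
    obtain ⟨rfl, hy⟩ := Prod.ext_iff.1 hb
    obtain rfl := φ.injective hy
    have hA := planeDet_app A (projRep x) (projRep m.1)
    have hB := planeDet_app B (projRep x) (projRep m.1)
    rw [h₁, h₂] at hA
    rw [h₄, h₃] at hB
    simp only [planeDet, Units.smul_def, Prod.smul_fst, Prod.smul_snd, smul_eq_mul] at *
    have : (c : F) = c' := by grind
    rw [Units.ext this]
  triangle {A B C l l' l''} h₁ h₂ h₃ h₄ h₅ h₆ hAB _ _ h h' h'' := by
    have hx := planeDet_projRep fun hx => h (h₂.eq_of_fst_eq h₃ hx)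
    have hz := planeDet_projRep fun hx => h'' (h₆.eq_of_fst_eq h₁ hx)
    refine hAB (UnimodularPair.ext_of_app hz ?_ (h₁.trans h₂.symm))
    have hB := planeDet_app B (projRep l.1) (projRep l'.1)
    apply eq_of_planeDet_eq (u := B.app (projRep l.1)) (v := B.app (projRep l'.1)) (hB ▸ hx)
    · rw [planeDet_app B, ← planeDet_app A (projRep l.1), h₁, h₂]
    · rw [planeDet_app B, ← planeDet_app C (projRep l'.1), h₃, h₄, h₅, h₆]

theorem exists_seven_path {y y' : Option F} (h : y ≠ y') :
    ∃ (A B : UnimodularPair F) (l l' m : Option F × Option F × Fˣ), A.Inc l ∧ A.Inc m ∧ B.Inc m ∧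
      B.Inc l' ∧ l.1 = l'.1 ∧ l.2.1 = y ∧ l'.2.1 = y' ∧ m.1 ≠ l.1 := by
  have hD := planeDet_projRep h
  have hd : planeDet (projRep none) (projRep (some (0 : F))) ≠ 0 := planeDet_projRep (by simp)
  set d := planeDet (projRep none) (projRep (some (0 : F)))
  set D := planeDet (projRep y) (projRep y') with hD'
  set b := d / D with hb
  have hb0 : b ≠ 0 := div_ne_zero hd hD
  obtain ⟨A, hA, hA'⟩ := UnimodularPair.exists_app (u' := (1 : Fˣ) • projRep y)
    (v' := projRep y + b • projRep y') hd (by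
      change d = _
      simp only [planeDet, Units.smul_def, Prod.smul_fst, Prod.smul_snd, smul_eq_mul, Prod.fst_add,
        Prod.snd_add, Units.val_one] at *
      clear_value d
      grind)
  obtain ⟨B, hB, hB'⟩ := UnimodularPair.exists_app
    (u' := (Units.mk0 (-b) (neg_ne_zero.2 hb0)) • projRep y')
    (v' := projRep y + b • projRep y') hd (by
      change d = _
      simp only [planeDet, Units.smul_def, Prod.smul_fst, Prod.smul_snd, smul_eq_mul, Prod.fst_add,
        Prod.snd_add, Units.val_mk0] at *
      clear_value d
      grind)
  obtain ⟨yc, hm⟩ := A.exists_inc (some 0)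
  exact ⟨A, B, (none, y, 1), (none, y', _), (some 0, yc), hA, hm, (hB'.trans hA'.symm).trans hm, hB,
    rfl, rfl, rfl, by simp⟩

end Symplectic

theorem SimpleGraph.egirth_le_seven {V : Type*} {G : SimpleGraph V} {a b c d e f g : V}
    (hab : G.Adj a b) (hbc : G.Adj b c) (hcd : G.Adj c d) (hde : G.Adj d e) (hef : G.Adj e f)
    (hfg : G.Adj f g) (hga : G.Adj g a) (hnd : [a, b, c, d, e, f, g].Nodup) : G.egirth ≤ 7 := by
  let w : G.Walk b a := .cons hbc (.cons hcd (.cons hde (.cons hef (.cons hfg (.cons hga .nil)))))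
  have hw : (w.cons hab).IsCycle := by
    simp only [List.nodup_cons, List.mem_cons, not_or] at hnd
    simp only [SimpleGraph.Walk.cons_isCycle_iff, SimpleGraph.Walk.isPath_def, w,
      SimpleGraph.Walk.support_cons, SimpleGraph.Walk.support_nil, SimpleGraph.Walk.edges_cons,
      SimpleGraph.Walk.edges_nil, List.nodup_cons, List.mem_cons, Sym2.eq_iff]
    grind
  simpa [w] using SimpleGraph.egirth_le_length hw

section Construction
variable {F : Type*} [Field F] {n : ℕ}

/-- The generalized quadrangle on the unimodular pairs and the grid `Option F × ZMod n` with the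
grid lines replaced by cycles. -/
def quadrangleGraph (φ : Option F ≃ ZMod n) :
    SimpleGraph (UnimodularPair F ⊕ (Option F × Option F × Fˣ) ⊕ (Option F × ZMod n)) :=
  gridGraph UnimodularPair.Inc (fun l => (l.1, φ l.2.1))

theorem girth_quadrangleGraph (φ : Option F ≃ ZMod n) (hn : 7 ≤ n) :
    (quadrangleGraph φ).girth = 7 := by
  have h1 : ((1 : ℕ) : ZMod n) ≠ 0 := ZMod.natCast_ne_zero_of_lt (by omega) (by omega)
  push_cast at h1
  have key : (quadrangleGraph φ).egirth = 7 := by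
    refine le_antisymm ?_ ((isGridSystem_unimodularPair φ).seven_le_egirth hn)
    obtain ⟨A, B, l, l', m, hA, hA', hB, hB', hx, hy, hy', hm⟩ :=
      exists_seven_path (φ.symm.injective.ne h1.symm)
    have hll : l ≠ l' := by rintro rfl; exact h1 (φ.symm.injective (hy'.symm.trans hy))
    have hAB : A ≠ B := by rintro rfl; exact hll (hA.eq_of_fst_eq hB' hx)
    refine SimpleGraph.egirth_le_seven (a := .inr (.inr (l.1, 0))) (b := .inr (.inl l))
      (c := .inl A) (d := .inr (.inl m)) (e := .inl B) (f := .inr (.inl l'))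
      (g := .inr (.inr (l.1, 1))) ?_ hA hA' hB hB' ?_ ?_ ?_
    · change (l.1, φ l.2.1) = _
      simp [hy]
    · change (l'.1, φ l'.2.1) = _
      simp [hy', hx]
    · refine ⟨by simp [h1], rfl, .inr (by simp)⟩
    · simp [hll, hAB, h1.symm]
      grind
  simp [SimpleGraph.girth, key]

variable [Finite F]

theorem card_unimodularPair :
    Nat.card (UnimodularPair F) = (Nat.card F + 1) * (Nat.card F - 1) * Nat.card F := by
  choose f hf hf' using exists_parametrization (F := F)
  rw [← Finite.card_option, ← Nat.card_units, ← Nat.card_prod, ← Nat.card_prod]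
  refine (Nat.card_eq_of_bijective
    (fun a : (Option F × Fˣ) × F => f (none, a.1) a.2) ⟨?_, fun A => ?_⟩).symm
  · rintro ⟨a, t⟩ ⟨b, s⟩ h
    have ha := (hf' (none, a) (f (none, a) t)).2 ⟨t, rfl⟩
    have hb := (hf' (none, b) (f (none, b) s)).2 ⟨s, rfl⟩
    simp only at h
    rw [h] at ha
    obtain rfl : a = b := (Prod.ext_iff.1 (ha.eq_of_fst_eq hb rfl)).2
    rw [hf _ h]
  · obtain ⟨a, ha⟩ := A.exists_inc none
    obtain ⟨t, ht⟩ := (hf' _ _).1 ha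
    exact ⟨(a, t), ht⟩

theorem card_neighborSet_quadrangleGraph (φ : Option F ≃ ZMod n) (hn : 3 ≤ n)
    (v : UnimodularPair F ⊕ (Option F × Option F × Fˣ) ⊕ (Option F × ZMod n)) :
    Nat.card ((quadrangleGraph φ).neighborSet v) = Nat.card F + 1 := by
  rcases v with A | l | ⟨x, i⟩
  · choose f hf using A.exists_inc
    have hN : (quadrangleGraph φ).neighborSet (.inl A) =
        Set.range fun x => .inr (.inl (x, f x)) := by
      ext v
      change GridAdj _ _ _ _ ↔ _
      rcases v with B | l | g <;> simp only [GridAdj, Set.mem_range, reduceCtorEq, exists_false,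
        Sum.inr.injEq, Sum.inl.injEq]
      exact ⟨fun h => ⟨l.1, (hf l.1).eq_of_fst_eq h rfl⟩, by rintro ⟨x, rfl⟩; exact hf x⟩
    rw [hN, Nat.card_range_of_injective, Finite.card_option]
    intro x y hxy
    simp only [Sum.inr.injEq, Sum.inl.injEq, Prod.mk.injEq] at hxy
    exact hxy.1
  · obtain ⟨f, hf, hf'⟩ := exists_parametrization l
    have hN : (quadrangleGraph φ).neighborSet (.inr (.inl l)) =
        Set.range fun t : Option F =>
          t.elim (.inr (.inr (l.1, φ l.2.1))) fun t => .inl (f t) := by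
      ext v
      change GridAdj _ _ _ _ ↔ _
      rcases v with B | m | g <;> simp [GridAdj, Option.exists, hf']
    rw [hN, Nat.card_range_of_injective, Finite.card_option]
    rintro (_ | s) (_ | t) hst <;> simp_all [hf.eq_iff]
  · have h1 : ((1 : ℕ) : ZMod n) ≠ 0 := ZMod.natCast_ne_zero_of_lt (by omega) (by omega)
    have h2 : ((2 : ℕ) : ZMod n) ≠ 0 := ZMod.natCast_ne_zero_of_lt (by omega) (by omega)
    push_cast at h1 h2
    have hN : (quadrangleGraph φ).neighborSet (.inr (.inr (x, i))) =
        Set.range fun t : Option (Option Fˣ) => t.elim (.inr (.inr (x, i + 1)))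
          fun t => t.elim (.inr (.inr (x, i - 1))) fun c => .inr (.inl (x, φ.symm i, c)) := by
      ext v
      change GridAdj _ _ _ _ ↔ _
      rcases v with B | ⟨z, y, c⟩ | ⟨z, j⟩
      · simp [GridAdj, Option.exists]
      · simp [GridAdj, Option.exists, Equiv.eq_symm_apply, eq_comm]
      · simp [GridAdj, Option.exists]
        grind
    have : 0 < Nat.card Fˣ := Nat.card_pos
    rw [hN, Nat.card_range_of_injective, Finite.card_option, Finite.card_option]
    · rw [Nat.card_units] at *
      omega
    · rintro (_ | _ | s) (_ | _ | t) hst <;> simp at hst ⊢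
      · exact h2 (by linear_combination hst)
      · exact h2 (by linear_combination -hst)
      · exact hst

end Construction

theorem IsPrimePow.exists_field {q : ℕ} (hq : IsPrimePow q) :
    ∃ (F : Type) (_ : Field F) (_ : Finite F), Nat.card F = q := by
  obtain ⟨p, k, hp, hk, rfl⟩ := hq
  have : Fact p.Prime := ⟨hp.nat_prime⟩
  exact ⟨GaloisField p k, inferInstance, inferInstance, GaloisField.card p k hk.ne'⟩


/-- `cageNum k g` is `n(k,g)`, the minimum number of vertices of a `k`-regular graph of
girth `g` (the order of a `(k,g)`-cage). -/
noncomputable def cageNum (k g : ℕ) : ℕ :=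
  sInf {n | ∃ G : SimpleGraph (Fin n),
    (∀ v, Nat.card (G.neighborSet v) = k) ∧ G.girth = g}

/-- For every prime power `q ≥ 7` there is a `(q+1)`-regular graph of girth exactly 7 on
`2q³ + 2q²` vertices; consequently `n(q+1,7) ≤ 2(q+1)³ − 4(q+1)² + 2(q+1)`. -/
theorem exists_q_add_one_regular_girth_seven (q : ℕ) (hq : IsPrimePow q) (h7 : 7 ≤ q) :
    (∃ G : SimpleGraph (Fin (2 * q ^ 3 + 2 * q ^ 2)),
      (∀ v, Nat.card (G.neighborSet v) = q + 1) ∧ G.girth = 7) ∧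
    cageNum (q + 1) 7 ≤ 2 * (q + 1) ^ 3 - 4 * (q + 1) ^ 2 + 2 * (q + 1) := by
  have key : ∃ G : SimpleGraph (Fin (2 * q ^ 3 + 2 * q ^ 2)),
      (∀ v, Nat.card (G.neighborSet v) = q + 1) ∧ G.girth = 7 := by
    obtain ⟨F, _, _, hF⟩ := hq.exists_field
    have hX : Nat.card (Option F) = q + 1 := by rw [Finite.card_option, hF]
    obtain ⟨φ⟩ : Nonempty (Option F ≃ ZMod (q + 1)) :=
      Finite.card_eq.1 (by rw [hX, Nat.card_zmod])
    have hV : Nat.card (UnimodularPair F ⊕ (Option F × Option F × Fˣ) ⊕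
        (Option F × ZMod (q + 1))) = 2 * q ^ 3 + 2 * q ^ 2 := by
      simp only [Nat.card_sum, Nat.card_prod, card_unimodularPair, hX, Nat.card_units,
        Nat.card_zmod, hF]
      obtain ⟨k, rfl⟩ : ∃ k, q = k + 1 := ⟨q - 1, by omega⟩
      simp only [Nat.add_sub_cancel]
      ring
    let ψ := Finite.equivFinOfCardEq hV
    let e := SimpleGraph.Iso.map ψ (quadrangleGraph φ)
    refine ⟨(quadrangleGraph φ).map ψ, fun v => ?_, ?_⟩
    · rw [← e.apply_symm_apply v, ← Nat.card_congr (e.mapNeighborSet _),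
        card_neighborSet_quadrangleGraph φ (by omega), hF]
    · rw [← e.girth_eq, girth_quadrangleGraph φ (by omega)]
  refine ⟨key, (Nat.sInf_le key).trans_eq ?_⟩
  obtain ⟨k, rfl⟩ : ∃ k, q = k + 1 := ⟨q - 1, by omega⟩
  rw [← Nat.sub_add_comm (by nlinarith [sq_nonneg (k + 2)])]
  apply Nat.eq_sub_of_add_eq
  ring
end

section
/- For every odd prime power q ≥ 3, n(q+1,7) ≤ 2q³ + 2q² + q + 2, i.e., there exists a (q+1)-regular graph of girth 7 on 2q³ + 2q² + q + 2 vertices. -/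
namespace GirthSeven

variable {F : Type*} [Field F]

/-- Points of the quadrangle `T₂(O)`, `O` the conic `{(1, t, t²)} ∪ {(0, 0, 1)}`: affine
points, planes meeting the plane at infinity in the tangent to `O` at `t`, and one further point. -/
inductive Pt (F : Type*)
  | aff (x y z : F)
  | plane (t : Option F) (c : F)
  | inf

/-- Lines of `T₂(O)`: affine lines whose direction `t` lies in `O`, and the points of `O`. -/
inductive Ln (F : Type*)
  | aff (t : Option F) (c u : F)
  | dir (t : Option F)

/-- Incidence in `T₂(O)`. -/
def Inc : Pt F → Ln F → Prop
  | .aff x y _, .aff none c u => x = c ∧ y = u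
  | .aff x y z, .aff (some t) c u => t ^ 2 * x - 2 * t * y + z = c ∧ y - t * x = u
  | .plane t c, .aff t' c' _ => t = t' ∧ c = c'
  | .plane t _, .dir t' => t = t'
  | .inf, .dir _ => True
  | _, _ => False

/-- The lines of one parallel class of the grid cut out by the plane `y = 0`, except `dir none`. -/
def Deleted : Ln F → Prop
  | .aff t _ u => t = some 0 ∧ u = 0
  | .dir _ => False

/-- On the deleted line of height `i`, match points with `x`-coordinates of sum `2 * i`, and the
point with `x`-coordinate `i` with the point at infinity. -/
def Mate : Pt F → Pt F → Prop
  | .aff x y z, .aff x' y' z' => y = 0 ∧ y' = 0 ∧ z = z' ∧ x ≠ x' ∧ x + x' = 2 * z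
  | .aff x y z, .plane t c => y = 0 ∧ t = some 0 ∧ c = z ∧ x = z
  | .plane t c, .aff x y z => y = 0 ∧ t = some 0 ∧ c = z ∧ x = z
  | _, _ => False

theorem eq_of_chords {s s' x y z x' y' z' : F}
    (h₁ : s ^ 2 * x - 2 * s * y + z = s ^ 2 * x' - 2 * s * y' + z')
    (h₂ : y - s * x = y' - s * x') (h₃ : y - s' * x = y' - s' * x') :
    s = s' ∨ x = x' ∧ y = y' ∧ z = z' := by
  have h : (s - s') * (x - x') = 0 := by linear_combination h₃ - h₂
  rcases mul_eq_zero.mp h with h | h <;> grind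

theorem eq_of_chord_of_tangent {s s' x y z x' y' z' : F}
    (h₁ : s ^ 2 * x - 2 * s * y + z = s ^ 2 * x' - 2 * s * y' + z')
    (h₂ : y - s * x = y' - s * x')
    (h₃ : s' ^ 2 * x - 2 * s' * y + z = s' ^ 2 * x' - 2 * s' * y' + z') :
    s = s' ∨ x = x' ∧ y = y' ∧ z = z' := by
  have h : (s - s') ^ 2 * (x - x') = 0 := by linear_combination h₃ - h₁ + 2 * (s' - s) * h₂
  rcases mul_eq_zero.mp h with h | h <;> grind

theorem eq_of_triangle {s s' s'' x y z x' y' z' x'' y'' z'' : F}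
    (h₁ : s ^ 2 * x - 2 * s * y + z = s ^ 2 * x' - 2 * s * y' + z')
    (h₂ : y - s * x = y' - s * x')
    (h₃ : s' ^ 2 * x' - 2 * s' * y' + z' = s' ^ 2 * x'' - 2 * s' * y'' + z'')
    (h₄ : y' - s' * x' = y'' - s' * x'')
    (h₅ : s'' ^ 2 * x - 2 * s'' * y + z = s'' ^ 2 * x'' - 2 * s'' * y'' + z'')
    (h₆ : y - s'' * x = y'' - s'' * x'') :
    s = s' ∨ s = s'' ∨ x = x' ∧ y = y' ∧ z = z' := by
  have h : (s - s') * ((s - s'') * (x - x')) = 0 := by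
    linear_combination (s' + s'' - 2 * s) * h₂ + (s'' - s') * h₄ + (s'' - s') * h₆ - h₁ - h₃ + h₅
  rcases mul_eq_zero.mp h with h | h
  · grind
  rcases mul_eq_zero.mp h with h | h <;> grind

theorem Inc.eq_or_eq {p p' : Pt F} {l m : Ln F} (h₁ : Inc p l) (h₂ : Inc p' l) (h₃ : Inc p m)
    (h₄ : Inc p' m) : p = p' ∨ l = m := by
  rcases p with ⟨x, y, z⟩ | ⟨_ | t, c⟩ | _ <;> rcases p' with ⟨x', y', z'⟩ | ⟨_ | t', c'⟩ | _ <;>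
    rcases l with ⟨_ | s, d, u⟩ | ⟨_ | s⟩ <;> rcases m with ⟨_ | s', d', u'⟩ | ⟨_ | s'⟩ <;>
    simp only [Inc, reduceCtorEq, false_and, Option.some.injEq] at h₁ h₂ h₃ h₄ <;>
    first | grind | grind [eq_of_chords (s := s) (s' := s') (x := x) (x' := x')]

theorem Inc.no_triangle {p₁ p₂ p₃ : Pt F} {l₁ l₂ l₃ : Ln F} (h₁₂ : Inc p₁ l₂) (h₁₃ : Inc p₁ l₃)
    (h₂₁ : Inc p₂ l₁) (h₂₃ : Inc p₂ l₃) (h₃₁ : Inc p₃ l₁) (h₃₂ : Inc p₃ l₂) :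
    p₁ = p₂ ∨ p₂ = p₃ ∨ p₁ = p₃ ∨ l₁ = l₂ ∨ l₂ = l₃ ∨ l₁ = l₃ := by
  rcases p₁ with ⟨x, y, z⟩ | ⟨_ | t, c⟩ | _ <;> rcases p₂ with ⟨x', y', z'⟩ | ⟨_ | t', c'⟩ | _ <;>
    rcases l₃ with ⟨_ | s, d, u⟩ | ⟨_ | s⟩ <;>
    simp only [Inc, reduceCtorEq, false_and, Option.some.injEq] at h₁₃ h₂₃ <;>
    rcases p₃ with ⟨x'', y'', z''⟩ | ⟨_ | t'', c''⟩ | _ <;>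
    rcases l₁ with ⟨_ | s', d', u'⟩ | ⟨_ | s'⟩ <;>
    simp only [Inc, reduceCtorEq, false_and, Option.some.injEq] at h₂₁ h₃₁ <;>
    rcases l₂ with ⟨_ | s'', d'', u''⟩ | ⟨_ | s''⟩ <;>
    simp only [Inc, reduceCtorEq, false_and, Option.some.injEq] at h₁₂ h₃₂ <;>
    first | grind | grind [eq_of_triangle (s := s) (s' := s') (s'' := s''),
      eq_of_chord_of_tangent]


theorem Mate.symm {p p' : Pt F} (h : Mate p p') : Mate p' p := by
  rcases p with _ | _ | _ <;> rcases p' with _ | _ | _ <;> simp only [Mate] at h ⊢ <;> grind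

theorem Mate.ne {p p' : Pt F} (h : Mate p p') : p ≠ p' := by
  rcases p with _ | _ | _ <;> rcases p' with _ | _ | _ <;> simp only [Mate] at h <;> grind

theorem Mate.right_unique {p r r' : Pt F} (h : Mate p r) (h' : Mate p r') : r = r' := by
  rcases p with _ | _ | _ <;> rcases r with _ | _ | _ <;> rcases r' with _ | _ | _ <;>
    simp only [Mate] at h h' <;> grind

theorem Mate.exists_deleted {p p' : Pt F} (h : Mate p p') :
    ∃ d, Deleted d ∧ Inc p d ∧ Inc p' d := by
  rcases p with ⟨x, y, z⟩ | ⟨t, c⟩ | _ <;> rcases p' with ⟨x', y', z'⟩ | ⟨t', c'⟩ | _ <;>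
    simp only [Mate] at h
  · exact ⟨.aff (some 0) z 0, by simp only [Deleted, Inc]; grind⟩
  · exact ⟨.aff (some 0) z 0, by simp only [Deleted, Inc]; grind⟩
  · exact ⟨.aff (some 0) c 0, by simp only [Deleted, Inc]; grind⟩

theorem Mate.not_inc_path {p p' r : Pt F} {l m : Ln F} (h : Mate p p') (hl : ¬Deleted l)
    (hm : ¬Deleted m) (h₁ : Inc p l) (h₂ : Inc r l) (h₃ : Inc r m) (h₄ : Inc p' m) : False := by
  obtain ⟨d, hd, hp, hp'⟩ := h.exists_deleted
  have := h.ne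
  have hdl : d ≠ l := by rintro rfl; exact hl hd
  have hdm : d ≠ m := by rintro rfl; exact hm hd
  have := Inc.no_triangle h₁ hp h₄ hp' h₃ h₂
  grind [Inc.eq_or_eq]

theorem Mate.eq_of_inc {p p' r r' : Pt F} {l m : Ln F} (h2 : (2 : F) ≠ 0) (h : Mate p p')
    (h' : Mate r r') (hl : ¬Deleted l) (hm : ¬Deleted m) (h₁ : Inc p l) (h₂ : Inc r l)
    (h₃ : Inc p' m) (h₄ : Inc r' m) : p = r := by
  rcases p with _ | ⟨_ | _, _⟩ | _ <;> rcases r with _ | ⟨_ | _, _⟩ | _ <;>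
    rcases l with ⟨_ | _, _, _⟩ | ⟨_ | _⟩ <;>
    simp only [Inc, Deleted, Option.some.injEq] at h₁ h₂ hl <;>
    rcases p' with _ | ⟨_ | _, _⟩ | _ <;> rcases r' with _ | ⟨_ | _, _⟩ | _ <;>
    simp only [Mate] at h h' <;>
    rcases m with ⟨_ | _, _, _⟩ | ⟨_ | _⟩ <;>
    simp only [Inc, Deleted, Option.some.injEq] at h₃ h₄ hm <;>
    grind [mul_right_inj' h2]

/-- The incidence graph of `T₂(O)` with the deleted lines isolated and the matching added. -/
def graph (F : Type*) [Field F] : SimpleGraph (Pt F ⊕ Ln F) where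
  Adj
    | .inl p, .inl p' => Mate p p'
    | .inl p, .inr l => Inc p l ∧ ¬Deleted l
    | .inr l, .inl p => Inc p l ∧ ¬Deleted l
    | .inr _, .inr _ => False
  symm := ⟨by rintro (p | l) (p' | l') h; exacts [h.symm, h, h, h]⟩
  loopless := ⟨by rintro (p | l) h; exacts [h.ne rfl, h]⟩

theorem seven_le_egirth_of_no_short_cycle {V : Type*} {G : SimpleGraph V}
    (h₃ : ∀ a b c, G.Adj a b → G.Adj b c → G.Adj c a → False)
    (h₄ : ∀ a b c d, G.Adj a b → G.Adj b c → G.Adj c d → G.Adj d a → a = c ∨ b = d)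
    (h₅ : ∀ a b c d e, G.Adj a b → G.Adj b c → G.Adj c d → G.Adj d e → G.Adj e a →
      a = c ∨ b = d ∨ c = e ∨ d = a ∨ e = b)
    (h₆ : ∀ a b c d e f, G.Adj a b → G.Adj b c → G.Adj c d → G.Adj d e → G.Adj e f → G.Adj f a →
      a = c ∨ b = d ∨ c = e ∨ d = f ∨ e = a ∨ f = b) : 7 ≤ G.egirth := by
  rw [SimpleGraph.le_egirth]
  intro a w hw
  by_contra! hlt
  have hlt : w.length < 7 := by exact_mod_cast hlt
  have hge := hw.three_le_length
  have adj (i : ℕ) (hi : i < w.length) := w.adj_getVert_succ hi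
  have last : w.getVert w.length = w.getVert 0 := by simp
  have inj (i j : ℕ) (hi : i < w.length) (hj : j < w.length) (h : w.getVert i = w.getVert j) :
      i = j := hw.getVert_injOn' (by grind) (by grind) h
  generalize w.length = n at *
  interval_cases n
  · have := adj 2 (by lia)
    rw [last] at this
    exact h₃ _ _ _ (adj 0 (by lia)) (adj 1 (by lia)) this
  · have := adj 3 (by lia)
    rw [last] at this
    have := h₄ _ _ _ _ (adj 0 (by lia)) (adj 1 (by lia)) (adj 2 (by lia)) this
    grind
  · have := adj 4 (by lia)
    rw [last] at this
    have := h₅ _ _ _ _ _ (adj 0 (by lia)) (adj 1 (by lia)) (adj 2 (by lia)) (adj 3 (by lia)) this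
    grind
  · have := adj 5 (by lia)
    rw [last] at this
    have := h₆ _ _ _ _ _ _ (adj 0 (by lia)) (adj 1 (by lia)) (adj 2 (by lia)) (adj 3 (by lia))
      (adj 4 (by lia)) this
    grind

theorem egirth_le_seven {V : Type*} {G : SimpleGraph V} {a b c d e f g : V}
    (hab : G.Adj a b) (hbc : G.Adj b c) (hcd : G.Adj c d) (hde : G.Adj d e) (hef : G.Adj e f)
    (hfg : G.Adj f g) (hga : G.Adj g a) (hnd : [a, b, c, d, e, f, g].Nodup) : G.egirth ≤ 7 := by
  let w : G.Walk a a := .cons hab <| .cons hbc <| .cons hcd <| .cons hde <| .cons hef <|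
    .cons hfg <| .cons hga .nil
  have hw : w.IsCycle := by
    simp only [w, SimpleGraph.Walk.cons_isCycle_iff]
    simp only [List.nodup_cons, List.mem_cons, not_or, List.not_mem_nil] at hnd
    simp [SimpleGraph.Walk.cons_isPath_iff, hnd, Ne.symm]
  exact SimpleGraph.egirth_le_length hw

set_option maxHeartbeats 4000000 in
theorem seven_le_egirth_graph (h2 : (2 : F) ≠ 0) : 7 ≤ (graph F).egirth := by
  apply seven_le_egirth_of_no_short_cycle
  · rintro (a | a) (b | b) (c | c) <;> simp only [graph] <;>
      grind [Mate.symm, Mate.right_unique, Mate.ne, Mate.not_inc_path]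
  · rintro (a | a) (b | b) (c | c) (d | d) <;> simp only [graph] <;>
      grind [Mate.symm, Mate.right_unique, Mate.ne, Mate.not_inc_path, Inc.eq_or_eq]
  · rintro (a | a) (b | b) (c | c) (d | d) (e | e) <;> simp only [graph] <;>
      grind [Mate.symm, Mate.right_unique, Mate.ne, Mate.not_inc_path]
  · rintro (a | a) (b | b) (c | c) (d | d) (e | e) (f | f) <;> simp only [graph] <;>
      grind [Mate.symm, Mate.right_unique, Mate.eq_of_inc, Inc.no_triangle]

/-- The vertices that remain when the deleted lines are removed. -/
def remaining (F : Type*) [Field F] : Set (Pt F ⊕ Ln F) := {v | ∀ l, v = .inr l → ¬Deleted l}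

theorem mem_remaining_of_adj {v w : Pt F ⊕ Ln F} (h : (graph F).Adj v w) : w ∈ remaining F := by
  rcases v with p | l <;> rcases w with p' | l' <;> simp_all [graph, remaining]

open Classical in
/-- The neighbours of a point, indexed by `Option F`. -/
noncomputable def pointNeighbor : Pt F → Option F → Pt F ⊕ Ln F
  | .aff x y _, none => .inr (.aff none x y)
  | .aff x y z, some t =>
    if t = 0 ∧ y = 0 then .inl (if x = z then .plane (some 0) z else .aff (2 * z - x) 0 z)
    else .inr (.aff (some t) (t ^ 2 * x - 2 * t * y + z) (y - t * x))
  | .plane t _, none => .inr (.dir t)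
  | .plane t c, some u =>
    if t = some 0 ∧ u = 0 then .inl (.aff c 0 c) else .inr (.aff t c u)
  | .inf, t => .inr (.dir t)

/-- The points of a line, indexed by `Option F`. -/
def linePoint : Ln F → Option F → Pt F
  | .aff t c _, none => .plane t c
  | .aff none c u, some s => .aff c u s
  | .aff (some t) c u, some s => .aff s (u + t * s) (c - t ^ 2 * s + 2 * t * (u + t * s))
  | .dir _, none => .inf
  | .dir t, some c => .plane t c

theorem pointNeighbor_injective (p : Pt F) : Function.Injective (pointNeighbor p) := by
  rintro (_ | t) (_ | t') h <;> rcases p with ⟨x, y, z⟩ | ⟨s, c⟩ | _ <;>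
    simp only [pointNeighbor] at h <;> grind

theorem linePoint_injective (l : Ln F) : Function.Injective (linePoint l) := by
  rintro (_ | t) (_ | t') h <;> rcases l with ⟨_ | s, c, u⟩ | ⟨s⟩ <;>
    simp only [linePoint] at h <;> grind

theorem graph_adj_inl_iff (h2 : (2 : F) ≠ 0) {p : Pt F} {w : Pt F ⊕ Ln F} :
    (graph F).Adj (.inl p) w ↔ w ∈ Set.range (pointNeighbor p) := by
  constructor
  · rcases p with ⟨x, y, z⟩ | ⟨t, c⟩ | _ <;>
      rcases w with (⟨x', y', z'⟩ | ⟨t', c'⟩ | _) | (⟨_ | t', c', u'⟩ | t') <;>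
      simp only [graph, Mate, Inc, Deleted, false_and, false_imp_iff] <;> intro h
    · exact ⟨some 0, by simp only [pointNeighbor]; grind⟩
    · exact ⟨some 0, by simp only [pointNeighbor]; grind⟩
    · exact ⟨none, by simp only [pointNeighbor]; grind⟩
    · exact ⟨some t', by simp only [pointNeighbor]; grind⟩
    · exact ⟨some 0, by simp only [pointNeighbor]; grind⟩
    · exact ⟨some u', by simp only [pointNeighbor]; grind⟩
    · exact ⟨some u', by simp only [pointNeighbor]; grind⟩
    · exact ⟨none, by simp only [pointNeighbor]; grind⟩
    · exact ⟨t', rfl⟩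
  · rintro ⟨_ | s, rfl⟩ <;> rcases p with ⟨x, y, z⟩ | ⟨t, c⟩ | _ <;>
      simp only [pointNeighbor] <;> (try split_ifs) <;>
      simp only [graph, Mate, Inc, Deleted] <;> grind [mul_right_inj' h2]

theorem inc_iff {p : Pt F} {l : Ln F} : Inc p l ↔ p ∈ Set.range (linePoint l) := by
  constructor
  · rcases p with ⟨x, y, z⟩ | ⟨t, c⟩ | _ <;> rcases l with ⟨_ | t', c', u'⟩ | t' <;>
      simp only [Inc, false_imp_iff] <;> intro h
    · exact ⟨some z, by simp only [linePoint]; grind⟩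
    · exact ⟨some x, by simp only [linePoint]; grind⟩
    · exact ⟨none, by simp only [linePoint]; grind⟩
    · exact ⟨none, by simp only [linePoint]; grind⟩
    · exact ⟨some c, by simp only [linePoint]; grind⟩
    · exact ⟨none, rfl⟩
  · rintro ⟨_ | s, rfl⟩ <;> rcases l with ⟨_ | t, c, u⟩ | t <;> simp only [linePoint, Inc] <;> grind

theorem card_neighborSet_graph (h2 : (2 : F) ≠ 0) {v : Pt F ⊕ Ln F}
    (hv : v ∈ remaining F) :
    Nat.card ((graph F).neighborSet v) = Nat.card (Option F) := by
  rcases v with p | l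
  · rw [← Nat.card_range_of_injective (pointNeighbor_injective p)]
    congr 2
    ext w
    exact graph_adj_inl_iff h2
  · rw [← Nat.card_range_of_injective (Sum.inl_injective.comp (linePoint_injective l)
      : Function.Injective (Sum.inl ∘ linePoint l : Option F → Pt F ⊕ Ln F))]
    congr 2
    ext (p | l')
    · simpa [graph, hv l rfl] using inc_iff
    · simp [graph]

/-- Points in coordinates. -/
def ptEquiv : Pt F ≃ (F × F × F) ⊕ (Option F × F) ⊕ Unit where
  toFun
    | .aff x y z => .inl (x, y, z)
    | .plane t c => .inr (.inl (t, c))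
    | .inf => .inr (.inr ())
  invFun
    | .inl (x, y, z) => .aff x y z
    | .inr (.inl (t, c)) => .plane t c
    | .inr (.inr ()) => .inf
  left_inv := by rintro (_ | _ | _) <;> rfl
  right_inv := by rintro (_ | _ | _) <;> rfl

/-- Lines in coordinates. -/
def lnEquiv : Ln F ≃ (Option F × F × F) ⊕ Option F where
  toFun
    | .aff t c u => .inl (t, c, u)
    | .dir t => .inr t
  invFun
    | .inl (t, c, u) => .aff t c u
    | .inr t => .dir t
  left_inv := by rintro (_ | _) <;> rfl
  right_inv := by rintro (_ | _) <;> rfl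

instance [Finite F] : Finite (Pt F) := .of_equiv _ ptEquiv.symm

instance [Finite F] : Finite (Ln F) := .of_equiv _ lnEquiv.symm

theorem card_remaining [Finite F] : Nat.card (remaining F) =
    2 * Nat.card F ^ 3 + 2 * Nat.card F ^ 2 + Nat.card F + 2 := by
  have hcompl : (remaining F)ᶜ = Set.range fun c : F ↦ Sum.inr (Ln.aff (some 0) c 0) := by
    ext (p | ⟨t, c, u⟩ | t) <;> simp [remaining, Deleted]
    grind
  have hcard : (remaining F)ᶜ.ncard = Nat.card F := by
    rw [hcompl, ← Nat.card_coe_set_eq]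
    exact Nat.card_range_of_injective fun a b h ↦ by simpa using h
  have hsum := Set.ncard_add_ncard_compl (remaining F)
  rw [hcard, Nat.card_sum, Nat.card_congr (ptEquiv (F := F)), Nat.card_congr (lnEquiv (F := F))]
    at hsum
  simp only [Nat.card_sum, Nat.card_prod, Finite.card_option, Nat.card_unique] at hsum
  rw [Nat.card_coe_set_eq]
  nlinarith

theorem egirth_induce_remaining_le : ((graph F).induce (remaining F)).egirth ≤ 7 := by
  have point (p : Pt F) : .inl p ∈ remaining F := by simp [remaining]
  have axis : .inr (.aff none 0 0) ∈ remaining F := by simp [remaining, Deleted]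
  have dir (t : Option F) : .inr (.dir t) ∈ remaining F := by simp [remaining, Deleted]
  apply egirth_le_seven (a := ⟨_, point (.aff 0 0 0)⟩) (b := ⟨_, axis⟩)
    (c := ⟨_, point (.plane none 0)⟩) (d := ⟨_, dir none⟩) (e := ⟨_, point .inf⟩)
    (f := ⟨_, dir (some 0)⟩) (g := ⟨_, point (.plane (some 0) 0)⟩) <;>
  simp [graph, Inc, Mate, Deleted]

theorem exists_graph [Finite F] (h2 : (2 : F) ≠ 0) {n : ℕ} (hn : Nat.card (remaining F) = n) :
    ∃ G : SimpleGraph (Fin n), (∀ v, Nat.card (G.neighborSet v) = Nat.card F + 1) ∧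
      G.girth = 7 := by
  let H := (graph F).induce (remaining F)
  let e : remaining F ≃ Fin n := Finite.equivFinOfCardEq hn
  let φ : H ≃g H.map e.toEmbedding := SimpleGraph.Iso.map e H
  refine ⟨H.map e.toEmbedding, fun v ↦ ?_, ?_⟩
  · obtain ⟨w, rfl⟩ := φ.surjective v
    rw [← Nat.card_congr (φ.mapNeighborSet w), ← Finite.card_option,
      ← card_neighborSet_graph h2 w.2]
    exact Nat.card_congr
      { toFun u := ⟨u.1, u.2⟩
        invFun u := ⟨⟨u.1, mem_remaining_of_adj u.2⟩, u.2⟩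
        left_inv _ := rfl
        right_inv _ := rfl }
  · rw [← φ.girth_eq, SimpleGraph.girth, le_antisymm egirth_induce_remaining_le
      ((seven_le_egirth_graph h2).trans
        (SimpleGraph.IsContained.egirth_le ⟨(SimpleGraph.Embedding.induce _).toCopy⟩))]
    rfl

end GirthSeven

/-- For every odd prime power `q ≥ 3`, `n(q+1,7) ≤ 2q³ + 2q² + q + 2`: there is a
`(q+1)`-regular graph of girth 7 on `2q³ + 2q² + q + 2` vertices. -/
theorem cage_bound_odd_prime_power (q : ℕ) (hq : IsPrimePow q) (hodd : Odd q)
    (h3 : 3 ≤ q) :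
    cageNum (q + 1) 7 ≤ 2 * q ^ 3 + 2 * q ^ 2 + q + 2 ∧
    ∃ G : SimpleGraph (Fin (2 * q ^ 3 + 2 * q ^ 2 + q + 2)),
      (∀ v, Nat.card (G.neighborSet v) = q + 1) ∧ G.girth = 7 := by
  obtain ⟨p, k, hp, hk, rfl⟩ := (isPrimePow_nat_iff q).mp hq
  have : Fact p.Prime := ⟨hp⟩
  have hcard : Nat.card (GaloisField p k) = p ^ k := GaloisField.card p k hk.ne'
  have h2 : (2 : GaloisField p k) ≠ 0 := by
    refine Ring.two_ne_zero ?_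
    rw [ringChar.eq (GaloisField p k) p]
    rintro rfl
    exact Nat.not_odd_iff_even.mpr (Nat.even_pow.mpr ⟨even_two, hk.ne'⟩) hodd
  have hG := GirthSeven.exists_graph h2 (GirthSeven.card_remaining (F := GaloisField p k))
  rw [hcard] at hG
  exact ⟨Nat.sInf_le hG, hG⟩
end

section
/- For every even prime power q ≥ 4, n(q+1,7) ≤ 2q³ + q² + 2q, i.e., there exists a (q+1)-regular graph of girth 7 on 2q³ + q² + 2q vertices. -/
/-- The graph on the points and lines of an incidence relation `I`, with additional edges between
points (relation `σ`) and between lines (relation `τ`). -/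
def amalgam {P L : Type*} (I : P → L → Prop) (σ : P → P → Prop) (τ : L → L → Prop)
    (hσ : ∀ p p', σ p p' → σ p' p ∧ p ≠ p') (hτ : ∀ l l', τ l l' → τ l' l ∧ l ≠ l') :
    SimpleGraph (P ⊕ L) where
  Adj
    | .inl p, .inl p' => σ p p'
    | .inl p, .inr l => I p l
    | .inr l, .inl p => I p l
    | .inr l, .inr l' => τ l l'
  symm := ⟨by
    rintro (p | l) (p' | l') h
    exacts [(hσ _ _ h).1, h, h, (hτ _ _ h).1]⟩
  loopless := ⟨by
    rintro (p | l) h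
    exacts [(hσ _ _ h).2 rfl, (hτ _ _ h).2 rfl]⟩

/-- Local conditions under which adding the partial matchings `σ` on points and `τ` on lines to an
incidence relation without digons and triangles creates no cycle of length less than `7`. -/
structure IsSparse {P L : Type*} (I : P → L → Prop) (σ : P → P → Prop) (τ : L → L → Prop) :
    Prop where
  symm_point : ∀ p p', σ p p' → σ p' p ∧ p ≠ p'
  symm_line : ∀ l l', τ l l' → τ l' l ∧ l ≠ l'
  digon : ∀ p p' l l', I p l → I p' l → I p l' → I p' l' → p = p' ∨ l = l'
  triangle : ∀ p₁ p₂ p₃ l₁ l₂ l₃, I p₁ l₂ → I p₁ l₃ → I p₂ l₁ → I p₂ l₃ → I p₃ l₁ → I p₃ l₂ →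
    p₁ = p₂ ∨ p₁ = p₃ ∨ p₂ = p₃ ∨ l₁ = l₂ ∨ l₁ = l₃ ∨ l₂ = l₃
  unique_point : ∀ p q r, σ p q → σ p r → q = r
  unique_line : ∀ l m n, τ l m → τ l n → m = n
  not_mem : ∀ p p' l l', σ p p' → τ l l' → ¬ I p l
  not_collinear : ∀ p p' l, σ p p' → I p l → ¬ I p' l
  not_concurrent : ∀ l l' p, τ l l' → I p l → ¬ I p l'
  far_point : ∀ p p' r l l', σ p p' → I p l → I r l → I r l' → ¬ I p' l'
  far_line : ∀ l l' m p p', τ l l' → I p l → I p m → I p' m → ¬ I p' l'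
  rectangle_point : ∀ p p' r r' l l', σ p p' → σ r r' → I p l → I r l → I p' l' → I r' l' → p = r
  rectangle_line : ∀ l l' m m' p p', τ l l' → τ m m' → I p l → I p m → I p' l' → I p' m' → l = m

namespace IsSparse

variable {P L : Type*} {I : P → L → Prop} {σ : P → P → Prop} {τ : L → L → Prop}

theorem no_three_cycle (h : IsSparse I σ τ) {v₀ v₁ v₂ : P ⊕ L}
    (h₀ : (amalgam I σ τ h.symm_point h.symm_line).Adj v₀ v₁)
    (h₁ : (amalgam I σ τ h.symm_point h.symm_line).Adj v₁ v₂)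
    (h₂ : (amalgam I σ τ h.symm_point h.symm_line).Adj v₂ v₀) : False := by
  obtain ⟨symmP, symmL, digon, triangle, uniqP, uniqL, nmem, ncol, nconc, farP, farL, rectP,
    rectL⟩ := h
  rcases v₀ with x0 | x0 <;> rcases v₁ with x1 | x1 <;> rcases v₂ with x2 | x2 <;>
    simp only [amalgam] at * <;> grind

theorem no_four_cycle (h : IsSparse I σ τ) {v₀ v₁ v₂ v₃ : P ⊕ L}
    (h₀ : (amalgam I σ τ h.symm_point h.symm_line).Adj v₀ v₁)
    (h₁ : (amalgam I σ τ h.symm_point h.symm_line).Adj v₁ v₂)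
    (h₂ : (amalgam I σ τ h.symm_point h.symm_line).Adj v₂ v₃)
    (h₃ : (amalgam I σ τ h.symm_point h.symm_line).Adj v₃ v₀)
    (h02 : v₀ ≠ v₂) (h13 : v₁ ≠ v₃) : False := by
  obtain ⟨symmP, symmL, digon, triangle, uniqP, uniqL, nmem, ncol, nconc, farP, farL, rectP,
    rectL⟩ := h
  rcases v₀ with x0 | x0 <;> rcases v₁ with x1 | x1 <;> rcases v₂ with x2 | x2 <;>
    rcases v₃ with x3 | x3 <;> simp only [amalgam] at * <;> grind

theorem no_five_cycle (h : IsSparse I σ τ) {v₀ v₁ v₂ v₃ v₄ : P ⊕ L}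
    (h₀ : (amalgam I σ τ h.symm_point h.symm_line).Adj v₀ v₁)
    (h₁ : (amalgam I σ τ h.symm_point h.symm_line).Adj v₁ v₂)
    (h₂ : (amalgam I σ τ h.symm_point h.symm_line).Adj v₂ v₃)
    (h₃ : (amalgam I σ τ h.symm_point h.symm_line).Adj v₃ v₄)
    (h₄ : (amalgam I σ τ h.symm_point h.symm_line).Adj v₄ v₀)
    (h02 : v₀ ≠ v₂) (h13 : v₁ ≠ v₃) (h24 : v₂ ≠ v₄) (h30 : v₃ ≠ v₀) (h41 : v₄ ≠ v₁) :
    False := by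
  obtain ⟨symmP, symmL, digon, triangle, uniqP, uniqL, nmem, ncol, nconc, farP, farL, rectP,
    rectL⟩ := h
  rcases v₀ with x0 | x0 <;> rcases v₁ with x1 | x1 <;> rcases v₂ with x2 | x2 <;>
    rcases v₃ with x3 | x3 <;> rcases v₄ with x4 | x4 <;> simp only [amalgam] at * <;> grind

set_option maxHeartbeats 1000000 in
theorem no_six_cycle (h : IsSparse I σ τ) {v₀ v₁ v₂ v₃ v₄ v₅ : P ⊕ L}
    (h₀ : (amalgam I σ τ h.symm_point h.symm_line).Adj v₀ v₁)
    (h₁ : (amalgam I σ τ h.symm_point h.symm_line).Adj v₁ v₂)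
    (h₂ : (amalgam I σ τ h.symm_point h.symm_line).Adj v₂ v₃)
    (h₃ : (amalgam I σ τ h.symm_point h.symm_line).Adj v₃ v₄)
    (h₄ : (amalgam I σ τ h.symm_point h.symm_line).Adj v₄ v₅)
    (h₅ : (amalgam I σ τ h.symm_point h.symm_line).Adj v₅ v₀)
    (h02 : v₀ ≠ v₂) (h13 : v₁ ≠ v₃) (h24 : v₂ ≠ v₄) (h35 : v₃ ≠ v₅) (h40 : v₄ ≠ v₀)
    (h51 : v₅ ≠ v₁) : False := by
  obtain ⟨symmP, symmL, digon, triangle, uniqP, uniqL, nmem, ncol, nconc, farP, farL, rectP,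
    rectL⟩ := h
  rcases v₀ with x0 | x0 <;> rcases v₁ with x1 | x1 <;> rcases v₂ with x2 | x2 <;>
    rcases v₃ with x3 | x3 <;> rcases v₄ with x4 | x4 <;> rcases v₅ with x5 | x5 <;>
    simp only [amalgam] at * <;> first
      | (have h := triangle _ _ _ _ _ _ h₅ h₀ h₂ h₁ h₃ h₄;
          clear triangle farP farL rectP rectL; grind)
      | (have h := triangle _ _ _ _ _ _ h₀ h₁ h₃ h₂ h₄ h₅;
          clear triangle farP farL rectP rectL; grind)
      | grind

theorem seven_le_length (h : IsSparse I σ τ) {v : P ⊕ L}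
    {w : (amalgam I σ τ h.symm_point h.symm_line).Walk v v} (hw : w.IsCycle) : 7 ≤ w.length := by
  have hadj : ∀ i < w.length, _ := fun i hi => w.adj_getVert_succ hi
  have hclose : w.getVert w.length = w.getVert 0 := by simp
  have hne : ∀ i < w.length, ∀ j < w.length, i ≠ j → w.getVert i ≠ w.getVert j :=
    fun i hi j hj hij heq => hij (hw.getVert_injOn' (by simp; lia) (by simp; lia) heq)
  have h3 := hw.three_le_length
  generalize w.getVert = f at *
  by_contra! hlt
  generalize w.length = n at *
  interval_cases n
  · exact h.no_three_cycle (hadj 0 (by simp)) (hadj 1 (by simp)) (hclose ▸ hadj 2 (by simp))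
  · exact h.no_four_cycle (hadj 0 (by simp)) (hadj 1 (by simp)) (hadj 2 (by simp))
      (hclose ▸ hadj 3 (by simp)) (hne _ (by simp) _ (by simp) (by simp))
      (hne _ (by simp) _ (by simp) (by simp))
  · apply h.no_five_cycle (hadj 0 (by simp)) (hadj 1 (by simp)) (hadj 2 (by simp))
      (hadj 3 (by simp)) (hclose ▸ hadj 4 (by simp)) <;>
    exact hne _ (by simp) _ (by simp) (by simp)
  · apply h.no_six_cycle (hadj 0 (by simp)) (hadj 1 (by simp)) (hadj 2 (by simp))
      (hadj 3 (by simp)) (hadj 4 (by simp)) (hclose ▸ hadj 5 (by simp)) <;>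
    exact hne _ (by simp) _ (by simp) (by simp)

end IsSparse

/-- Points of the symplectic quadrangle off the line `X₀ = X₃ = 0`: `affine t a b` is the point
`(t : a : b : 1)` and `infinite a b` is the point `(1 : a : b : 0)`. -/
inductive QuadPoint (F : Type*)
  | affine (t a b : F)
  | infinite (a b : F)

/-- Lines kept from the symplectic quadrangle: `generic a b c` joins `(1 : a : b : 0)` and
`(0 : b : c : 1)`, while `first c` joins `(0 : 1 : 0 : 0)` and `(0 : 0 : c : 1)`, and `second b`
joins `(0 : 0 : 1 : 0)` and `(1 : b : 0 : 0)`. -/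
inductive QuadLine (F : Type*)
  | generic (a b c : F)
  | first (c : F)
  | second (b : F)

section Quadrangle

variable {F : Type*} [Field F]

open QuadPoint QuadLine

/-- Incidence in the symplectic quadrangle. -/
def quadInc : QuadPoint F → QuadLine F → Prop
  | affine t x y, generic a b c => x = b + t * a ∧ y = c + t * b
  | infinite x y, generic a b _ => x = a ∧ y = b
  | affine t _ y, first c => t = 0 ∧ y = c
  | infinite x _, second b => x = b
  | _, _ => False

/-- The matching on the points of the deleted lines. -/
def quadPointMatch : QuadPoint F → QuadPoint F → Prop
  | affine t a b, affine t' a' b' => t ≠ 0 ∧ t' = t ∧ a' = a + t ∧ b' = b + t ^ 2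
  | _, _ => False

/-- The matching on the lines that lose a point. -/
def quadLineMatch : QuadLine F → QuadLine F → Prop
  | first c, first c' => c' = c + 1
  | second b, second b' => b' = b + 1
  | _, _ => False

theorem generic_eq_of_fst_eq {a b c a' b' c' t : F} (h : b + t * a = b' + t * a')
    (k : c + t * b = c' + t * b') (ha : a = a') : generic a b c = generic a' b' c' := by
  subst ha
  obtain rfl := add_right_cancel h
  rw [add_right_cancel k]

theorem quad_digon_generic {a b c a' b' c' t t' : F}
    (h : b + t * a = b' + t * a') (k : c + t * b = c' + t * b')
    (h' : b + t' * a = b' + t' * a') : t = t' ∨ generic a b c = generic a' b' c' := by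
  have key : (t - t') * (a - a') = 0 := by linear_combination h - h'
  rcases mul_eq_zero.1 key with e | e
  · exact .inl (sub_eq_zero.1 e)
  · exact .inr (generic_eq_of_fst_eq h k (sub_eq_zero.1 e))

theorem quad_digon_of_trd_eq {a b c a' b' c' t : F} (h : b + t * a = b' + t * a')
    (k : c + t * b = c' + t * b') (hc : c = c') : t = 0 ∨ generic a b c = generic a' b' c' := by
  subst hc
  refine or_iff_not_imp_left.2 fun ht => ?_
  obtain rfl := mul_left_cancel₀ ht (add_left_cancel k)
  rw [mul_left_cancel₀ ht (add_left_cancel h)]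

theorem quad_rectangle_generic [CharP F 2] {a b c a' b' c' t s : F}
    (h : b + t * a + t = b' + t * a') (k : c + t * b + t ^ 2 = c' + t * b')
    (h' : b + s * a + s = b' + s * a') (k' : c + s * b + s ^ 2 = c' + s * b') : t = s := by
  have h2 : (2 : F) = 0 := CharTwo.two_eq_zero
  have key : (t - s) ^ 2 = 0 := by
    linear_combination (k - k') - ((t - s) * h - t * (h - h')) - (t * s - s ^ 2) * h2
  exact sub_eq_zero.1 (pow_eq_zero_iff two_ne_zero |>.1 key)

theorem quad_triangle_generic {a₁ b₁ c₁ a₂ b₂ c₂ a₃ b₃ c₃ t₁ t₂ t₃ : F}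
    (h₁ : b₂ + t₁ * a₂ = b₃ + t₁ * a₃) (k₁ : c₂ + t₁ * b₂ = c₃ + t₁ * b₃)
    (h₂ : b₁ + t₂ * a₁ = b₃ + t₂ * a₃) (k₂ : c₁ + t₂ * b₁ = c₃ + t₂ * b₃)
    (h₃ : b₁ + t₃ * a₁ = b₂ + t₃ * a₂) (k₃ : c₁ + t₃ * b₁ = c₂ + t₃ * b₂) :
    t₁ = t₃ ∨ a₂ = a₃ ∨ t₁ = t₂ := by
  have key : (t₁ - t₃) * ((a₂ - a₃) * (t₁ - t₂)) = 0 := by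
    linear_combination (t₂ + t₃) * (h₂ - h₁ - h₃) + (k₂ - t₂ * h₂) - (k₁ - t₁ * h₁) -
      (k₃ - t₃ * h₃)
  simpa [sub_eq_zero] using key

theorem quad_triangle (p₁ p₂ p₃ : QuadPoint F) (l₁ l₂ l₃ : QuadLine F)
    (h12 : quadInc p₁ l₂) (h13 : quadInc p₁ l₃) (h21 : quadInc p₂ l₁) (h23 : quadInc p₂ l₃)
    (h31 : quadInc p₃ l₁) (h32 : quadInc p₃ l₂) :
    p₁ = p₂ ∨ p₁ = p₃ ∨ p₂ = p₃ ∨ l₁ = l₂ ∨ l₁ = l₃ ∨ l₂ = l₃ := by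
  rcases p₁ with ⟨t1, x1, y1⟩ | ⟨x1, y1⟩ <;> rcases l₂ with ⟨a2, b2, c2⟩ | c2 | c2 <;>
    simp only [quadInc] at h12 <;>
    rcases l₃ with ⟨a3, b3, c3⟩ | c3 | c3 <;> simp only [quadInc] at h13 <;>
    rcases p₂ with ⟨t2, x2, y2⟩ | ⟨x2, y2⟩ <;> simp only [quadInc] at h23 <;>
    rcases l₁ with ⟨a1, b1, c1⟩ | c1 | c1 <;> simp only [quadInc] at h21 <;>
    rcases p₃ with ⟨t3, x3, y3⟩ | ⟨x3, y3⟩ <;> simp only [quadInc] at h31 h32 <;>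
    try grind
  · have := quad_triangle_generic (h12.1.symm.trans h13.1) (h12.2.symm.trans h13.2)
      (h21.1.symm.trans h23.1) (h21.2.symm.trans h23.2) (h31.1.symm.trans h32.1)
      (h31.2.symm.trans h32.2)
    rcases this with e | e | e
    · grind
    · have := generic_eq_of_fst_eq (h12.1.symm.trans h13.1) (h12.2.symm.trans h13.2) e
      grind
    · grind
  · have := quad_digon_of_trd_eq (h12.1.symm.trans h13.1) (h12.2.symm.trans h13.2) (by grind)
    grind
  · have := quad_digon_of_trd_eq (h31.1.symm.trans h32.1) (h31.2.symm.trans h32.2) (by grind)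
    grind
  · have := quad_digon_of_trd_eq (h21.1.symm.trans h23.1) (h21.2.symm.trans h23.2) (by grind)
    grind

theorem quad_isSparse [CharP F 2] :
    IsSparse (quadInc (F := F)) quadPointMatch quadLineMatch where
  symm_point := by
    have h2 : (2 : F) = 0 := CharTwo.two_eq_zero
    rintro (_ | _) (_ | _) h <;> simp only [quadPointMatch] at * <;> grind
  symm_line := by
    have h2 : (2 : F) = 0 := CharTwo.two_eq_zero
    rintro (_ | _ | _) (_ | _ | _) h <;> simp only [quadLineMatch] at * <;> grind
  digon := by
    rintro (_ | _) (_ | _) (_ | _ | _) (_ | _ | _) h1 h2 h3 h4 <;>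
      simp only [quadInc] at * <;> try grind
    have := quad_digon_generic (h1.1.symm.trans h3.1) (h1.2.symm.trans h3.2)
      (h2.1.symm.trans h4.1)
    grind
  triangle := quad_triangle
  unique_point := by
    rintro (_ | _) (_ | _) (_ | _) h1 h2 <;> simp only [quadPointMatch] at * <;> grind
  unique_line := by
    rintro (_ | _ | _) (_ | _ | _) (_ | _ | _) h1 h2 <;> simp only [quadLineMatch] at * <;> grind
  not_mem := by
    rintro (_ | _) (_ | _) (_ | _ | _) (_ | _ | _) h1 h2 h3 <;>
      simp only [quadLineMatch, quadPointMatch, quadInc] at * <;> grind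
  not_collinear := by
    rintro (_ | _) (_ | _) (_ | _ | _) h1 h2 h3 <;>
      simp only [quadPointMatch, quadInc] at * <;> grind
  not_concurrent := by
    rintro (_ | _ | _) (_ | _ | _) (_ | _) h1 h2 h3 <;>
      simp only [quadLineMatch, quadInc] at * <;> grind
  far_point := by
    have h2 : (2 : F) = 0 := CharTwo.two_eq_zero
    rintro (_ | _) (_ | _) (_ | _) (_ | _ | _) (_ | _ | _) h1 h2 h3 h4 h5 <;>
      simp only [quadPointMatch, quadInc] at * <;> grind
  far_line := by
    rintro (_ | _ | _) (_ | _ | _) (_ | _ | _) (_ | _) (_ | _) h1 h2 h3 h4 h5 <;>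
      simp only [quadLineMatch, quadInc] at * <;> grind
  rectangle_point := by
    rintro (_ | _) (_ | _) (_ | _) (_ | _) (_ | _ | _) (_ | _ | _) h1 h2 h3 h4 h5 h6 <;>
      simp only [quadPointMatch, quadInc] at * <;> try grind
    obtain ⟨-, rfl, rfl, rfl⟩ := h1
    obtain ⟨-, rfl, rfl, rfl⟩ := h2
    obtain ⟨rfl, rfl⟩ := h3
    obtain ⟨rfl, rfl⟩ := h4
    obtain rfl := quad_rectangle_generic h5.1 h5.2 h6.1 h6.2
    rfl
  rectangle_line := by
    rintro (_ | _ | _) (_ | _ | _) (_ | _ | _) (_ | _ | _) (_ | _) (_ | _) h1 h2 h3 h4 h5 h6 <;>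
      simp only [quadLineMatch, quadInc] at * <;> grind

variable (F) in
/-- The incidence graph of the kept points and lines, completed by the two matchings. -/
def quadGraph [CharP F 2] : SimpleGraph (QuadPoint F ⊕ QuadLine F) :=
  amalgam quadInc quadPointMatch quadLineMatch quad_isSparse.symm_point quad_isSparse.symm_line

theorem exists_isCycle_length_seven {V : Type*} {G : SimpleGraph V} {v₀ v₁ v₂ v₃ v₄ v₅ v₆ : V}
    (h₀ : G.Adj v₀ v₁) (h₁ : G.Adj v₁ v₂) (h₂ : G.Adj v₂ v₃) (h₃ : G.Adj v₃ v₄)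
    (h₄ : G.Adj v₄ v₅) (h₅ : G.Adj v₅ v₆) (h₆ : G.Adj v₆ v₀)
    (h : [v₀, v₁, v₂, v₃, v₄, v₅, v₆].Nodup) :
    ∃ w : G.Walk v₀ v₀, w.IsCycle ∧ w.length = 7 := by
  refine ⟨.cons h₀ <| .cons h₁ <| .cons h₂ <| .cons h₃ <| .cons h₄ <| .cons h₅ <| .cons h₆ .nil,
    ?_, rfl⟩
  simp only [List.nodup_cons, List.mem_cons, List.not_mem_nil] at h
  rw [SimpleGraph.Walk.isCycle_def, SimpleGraph.Walk.isTrail_def]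
  simp
  grind

theorem quadGraph_girth [CharP F 2] : (quadGraph F).girth = 7 := by
  obtain ⟨w, hw, hw7⟩ := exists_isCycle_length_seven (G := quadGraph F)
    (v₀ := .inr (first 0)) (v₁ := .inl (affine 0 0 0)) (v₂ := .inr (generic 0 0 0))
    (v₃ := .inl (infinite 0 0)) (v₄ := .inr (generic 0 0 1)) (v₅ := .inl (affine 0 0 1))
    (v₆ := .inr (first 1)) (by simp [quadGraph, amalgam, quadInc])
    (by simp [quadGraph, amalgam, quadInc]) (by simp [quadGraph, amalgam, quadInc])
    (by simp [quadGraph, amalgam, quadInc]) (by simp [quadGraph, amalgam, quadInc])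
    (by simp [quadGraph, amalgam, quadInc])
    (by simp [quadGraph, amalgam, quadLineMatch, CharTwo.add_self_eq_zero]) (by simp)
  refine le_antisymm (hw7 ▸ SimpleGraph.girth_le_length hw) ?_
  obtain ⟨v, u, hu, hlen⟩ := SimpleGraph.exists_girth_eq_length.2 fun h => h w hw
  exact hlen ▸ quad_isSparse.seven_le_length hu

theorem card_neighborSet_eq_of_injective {V α : Type*} [Finite α] {G : SimpleGraph V} {v : V}
    (f : Option α → V) (hf : f.Injective) (h : ∀ u, G.Adj v u ↔ ∃ i, f i = u) :
    Nat.card (G.neighborSet v) = Nat.card α + 1 := by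
  have : G.neighborSet v = Set.range f := by ext u; exact h u
  rw [this, Nat.card_range_of_injective hf, Finite.card_option]

theorem quadGraph_card_neighborSet [Finite F] [CharP F 2] (v : QuadPoint F ⊕ QuadLine F) :
    Nat.card ((quadGraph F).neighborSet v) = Nat.card F + 1 := by
  have h2 : (2 : F) = 0 := CharTwo.two_eq_zero
  rcases v with (⟨t, a, b⟩ | ⟨a, b⟩) | (⟨a, b, c⟩ | c | b)
  · by_cases ht : t = 0
    · apply card_neighborSet_eq_of_injective
        (fun i => i.elim (.inr (first b)) fun x => .inr (generic x a b))
      · rintro (_ | x) (_ | y) <;> simp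
      · rintro ((_ | _) | (_ | _ | _)) <;>
          simp [quadGraph, amalgam, quadInc, quadPointMatch, ht, Option.exists]
    · apply card_neighborSet_eq_of_injective
        (fun i => i.elim (.inl (affine t (a + t) (b + t ^ 2)))
          fun x => .inr (generic x (a - t * x) (b - t * (a - t * x))))
      · rintro (_ | x) (_ | y) <;> simp <;> grind
      · rintro ((_ | _) | (_ | _ | _)) <;>
          simp [quadGraph, amalgam, quadInc, quadPointMatch, ht, Option.exists] <;> grind
  · apply card_neighborSet_eq_of_injective
      (fun i => i.elim (.inr (second a)) fun x => .inr (generic a b x))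
    · rintro (_ | x) (_ | y) <;> simp
    · rintro ((_ | _) | (_ | _ | _)) <;>
        simp [quadGraph, amalgam, quadInc, quadPointMatch, Option.exists]
  · apply card_neighborSet_eq_of_injective
      (fun i => i.elim (.inl (infinite a b)) fun x => .inl (affine x (b + x * a) (c + x * b)))
    · rintro (_ | x) (_ | y) <;> simp <;> grind
    · rintro ((_ | _) | (_ | _ | _)) <;>
        simp [quadGraph, amalgam, quadInc, quadLineMatch, Option.exists] <;> grind
  · apply card_neighborSet_eq_of_injective
      (fun i => i.elim (.inr (first (c + 1))) fun x => .inl (affine 0 x c))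
    · rintro (_ | x) (_ | y) <;> simp
    · rintro ((_ | _) | (_ | _ | _)) <;>
        simp [quadGraph, amalgam, quadInc, quadLineMatch, Option.exists] <;> grind
  · apply card_neighborSet_eq_of_injective
      (fun i => i.elim (.inr (second (b + 1))) fun x => .inl (infinite b x))
    · rintro (_ | x) (_ | y) <;> simp
    · rintro ((_ | _) | (_ | _ | _)) <;>
        simp [quadGraph, amalgam, quadInc, quadLineMatch, Option.exists] <;> grind

end Quadrangle

/-- Coordinates of points. -/
def quadPointEquiv (F : Type*) : QuadPoint F ≃ (F × F × F) ⊕ (F × F) where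
  toFun
    | .affine t a b => .inl (t, a, b)
    | .infinite a b => .inr (a, b)
  invFun
    | .inl (t, a, b) => .affine t a b
    | .inr (a, b) => .infinite a b
  left_inv := by rintro (_ | _) <;> rfl
  right_inv := by rintro (_ | _) <;> rfl

/-- Coordinates of lines. -/
def quadLineEquiv (F : Type*) : QuadLine F ≃ (F × F × F) ⊕ (F ⊕ F) where
  toFun
    | .generic a b c => .inl (a, b, c)
    | .first c => .inr (.inl c)
    | .second b => .inr (.inr b)
  invFun
    | .inl (a, b, c) => .generic a b c
    | .inr (.inl c) => .first c
    | .inr (.inr b) => .second b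
  left_inv := by rintro (_ | _ | _) <;> rfl
  right_inv := by rintro (_ | _ | _) <;> rfl

theorem exists_quad_equiv_fin (F : Type*) [Finite F] {q : ℕ} (hF : Nat.card F = q) :
    Nonempty (QuadPoint F ⊕ QuadLine F ≃ Fin (2 * q ^ 3 + q ^ 2 + 2 * q)) := by
  refine ⟨((quadPointEquiv F).sumCongr (quadLineEquiv F)).trans (Finite.equivFinOfCardEq ?_)⟩
  simp only [Nat.card_sum, Nat.card_prod, hF]
  ring

/-- For every even prime power `q ≥ 4`, `n(q+1,7) ≤ 2q³ + q² + 2q`: there is a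
`(q+1)`-regular graph of girth 7 on `2q³ + q² + 2q` vertices. -/
theorem cage_bound_even_prime_power (q : ℕ) (hq : IsPrimePow q) (heven : Even q)
    (h4 : 4 ≤ q) :
    cageNum (q + 1) 7 ≤ 2 * q ^ 3 + q ^ 2 + 2 * q ∧
    ∃ G : SimpleGraph (Fin (2 * q ^ 3 + q ^ 2 + 2 * q)),
      (∀ v, Nat.card (G.neighborSet v) = q + 1) ∧ G.girth = 7 := by
  suffices h : ∃ G : SimpleGraph (Fin (2 * q ^ 3 + q ^ 2 + 2 * q)),
      (∀ v, Nat.card (G.neighborSet v) = q + 1) ∧ G.girth = 7 from ⟨Nat.sInf_le h, h⟩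
  obtain ⟨p, k, hp, hk, rfl⟩ := hq
  obtain rfl : p = 2 := ((Nat.prime_dvd_prime_iff_eq Nat.prime_two hp.nat_prime).1
    (Nat.prime_two.dvd_of_dvd_pow heven.two_dvd)).symm
  have hcard : Nat.card (GaloisField 2 k) = 2 ^ k := GaloisField.card 2 k hk.ne'
  obtain ⟨e⟩ := exists_quad_equiv_fin (GaloisField 2 k) hcard
  let φ := SimpleGraph.Iso.map e (quadGraph (GaloisField 2 k))
  refine ⟨_, fun v => ?_, φ.girth_eq.symm.trans quadGraph_girth⟩
  exact (Nat.card_congr (φ.symm.mapNeighborSet v)).trans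
    ((quadGraph_card_neighborSet (φ.symm v)).trans (congrArg (· + 1) hcard))
end
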